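/- For every nonnegative integer n, 2·b̅₅(10n) = c₅(10n+2). -/

import Mathlib

open scoped BigOperators

/-- The q-Pochhammer infinite product `(a; q)_∞ = ∏_{k≥0} (1 - a q^k)`. -/
noncomputable def qpoch (a q : ℂ) : ℂ := ∏' k : ℕ, (1 - a * q ^ k)

/-- `φ(-q) = (q;q)_∞² / (q²;q²)_∞`. -/
noncomputable def phiNeg (q : ℂ) : ℂ := qpoch q q ^ 2 / qpoch (q ^ 2) (q ^ 2)

/-- `ψ(-q) = (q;q)_∞ (q⁴;q⁴)_∞ / (q²;q²)_∞`. -/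
noncomputable def psiNeg (q : ℂ) : ℂ :=
  qpoch q q * qpoch (q ^ 4) (q ^ 4) / qpoch (q ^ 2) (q ^ 2)

open Filter Topology

/-! ### Basic facts on the infinite products -/

lemma qp_summable (a : ℂ) {q : ℂ} (hq : ‖q‖ < 1) : Summable fun k : ℕ => ‖-(a * q ^ k)‖ := by
  simp only [norm_neg, norm_mul, norm_pow]
  exact (summable_geometric_of_lt_one (norm_nonneg _) hq).mul_left _

lemma qp_mult (a : ℂ) {q : ℂ} (hq : ‖q‖ < 1) : Multipliable fun k : ℕ => (1 - a * q ^ k) := by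
  simpa [sub_eq_add_neg] using multipliable_one_add_of_summable (qp_summable a hq)

lemma norm_pow_lt {q : ℂ} (hq : ‖q‖ < 1) {n : ℕ} (hn : n ≠ 0) : ‖q ^ n‖ < 1 := by
  rw [norm_pow]; exact pow_lt_one₀ (norm_nonneg _) hq hn

lemma qp_ne {a q : ℂ} (hq : ‖q‖ < 1) (ha : ‖a‖ < 1) : qpoch a q ≠ 0 := by
  have := tprod_one_add_ne_zero_of_summable (f := fun k : ℕ => -(a * q ^ k)) ?_ (qp_summable a hq)
  · simpa [qpoch, sub_eq_add_neg] using this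
  · intro k h
    have h1 : a * q ^ k = 1 := by linear_combination -h
    have h2 : ‖a * q ^ k‖ < 1 := by
      rw [norm_mul, norm_pow]
      calc ‖a‖ * ‖q‖ ^ k ≤ ‖a‖ * 1 := by
            gcongr; exact pow_le_one₀ (norm_nonneg _) hq.le
        _ < 1 := by simpa using ha
    rw [h1] at h2; simp at h2

lemma tprod_split (f : ℕ → ℂ) (hf : Multipliable f) (p : ℕ) [NeZero p]
    (hr : ∀ r : Fin p, Multipliable fun k : ℕ => f (p * k + r)) :
    ∏' k, f k = ∏ r : Fin p, ∏' k : ℕ, f (p * k + r) := by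
  have e : ∀ x : Fin p × ℕ, (f ∘ ((Equiv.prodComm (Fin p) ℕ).trans (Nat.divModEquiv p).symm)) x
      = f (p * x.2 + x.1) := by
    intro x
    simp only [Function.comp, Equiv.trans_apply, Equiv.prodComm_apply, Prod.swap,
      Nat.divModEquiv_symm_apply, mul_comm]
  have h3 : Multipliable fun x : Fin p × ℕ => f (p * x.2 + x.1) :=
    ((((Equiv.prodComm (Fin p) ℕ).trans (Nat.divModEquiv p).symm).multipliable_iff).2 hf).congr
      e
  rw [← ((Equiv.prodComm (Fin p) ℕ).trans (Nat.divModEquiv p).symm).tprod_eq f]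
  refine (tprod_congr e).trans ?_
  rw [h3.tprod_prod' hr, tprod_fintype]

lemma qp_split (a : ℂ) {q : ℂ} (hq : ‖q‖ < 1) (p : ℕ) [NeZero p] :
    qpoch a q = ∏ r : Fin p, qpoch (a * q ^ (r : ℕ)) (q ^ p) := by
  have hp : ‖q ^ p‖ < 1 := norm_pow_lt hq (NeZero.ne p)
  have e : ∀ (r : Fin p) (k : ℕ), 1 - (a * q ^ (r : ℕ)) * (q ^ p) ^ k =
      1 - a * q ^ (p * k + (r : ℕ)) := by
    intro r k
    rw [pow_add, pow_mul]; ring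
  unfold qpoch
  rw [tprod_split (fun k => 1 - a * q ^ k) (qp_mult a hq) p]
  · refine Finset.prod_congr rfl fun r _ => tprod_congr fun k => (e r k).symm
  · intro r
    exact (qp_mult (a * q ^ (r : ℕ)) hp).congr (e r)

lemma qp_neg (a : ℂ) {q : ℂ} (hq : ‖q‖ < 1) :
    qpoch a q * qpoch (-a) q = qpoch (a ^ 2) (q ^ 2) := by
  unfold qpoch
  rw [← (qp_mult a hq).tprod_mul (qp_mult (-a) hq)]
  refine tprod_congr fun k => ?_
  ring

lemma qp_five {ζ : ℂ} (h : 1 + ζ + ζ ^ 2 + ζ ^ 3 + ζ ^ 4 = 0) (a : ℂ) {q : ℂ} (hq : ‖q‖ < 1) :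
    qpoch a q * qpoch (ζ * a) q * qpoch (ζ ^ 2 * a) q * qpoch (ζ ^ 3 * a) q * qpoch (ζ ^ 4 * a) q
      = qpoch (a ^ 5) (q ^ 5) := by
  unfold qpoch
  have m0 := qp_mult a hq
  have m1 := qp_mult (ζ * a) hq
  have m2 := qp_mult (ζ ^ 2 * a) hq
  have m3 := qp_mult (ζ ^ 3 * a) hq
  have m4 := qp_mult (ζ ^ 4 * a) hq
  rw [← m0.tprod_mul m1, ← (m0.mul m1).tprod_mul m2, ← ((m0.mul m1).mul m2).tprod_mul m3,
    ← (((m0.mul m1).mul m2).mul m3).tprod_mul m4]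
  refine tprod_congr fun k => ?_
  have key : ∀ x : ℂ, (1 - x) * (1 - ζ * x) * (1 - ζ ^ 2 * x) * (1 - ζ ^ 3 * x) * (1 - ζ ^ 4 * x)
      = 1 - x ^ 5 := by
    intro x
    linear_combination (-x + x^2*(ζ+ζ^3) - x^3*(ζ^3+ζ^5) + x^4*ζ^6 - x^5*(ζ-1)*(1+ζ^5)) * h
  have := key (a * q ^ k)
  linear_combination this

/-- Euler function. -/
noncomputable def EE (q : ℂ) : ℂ := qpoch q q

lemma EE_ne {q : ℂ} (hq : ‖q‖ < 1) : EE q ≠ 0 := qp_ne hq hq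

lemma EE_split2 {q : ℂ} (hq : ‖q‖ < 1) : EE q = qpoch q (q ^ 2) * EE (q ^ 2) := by
  have := qp_split q hq 2
  simp only [Fin.prod_univ_two, Fin.val_zero, Fin.val_one, pow_zero, mul_one, pow_one] at this
  rw [EE, this, EE]
  congr 2; ring

lemma qp_split5 (a : ℂ) {q : ℂ} (hq : ‖q‖ < 1) : qpoch a q = qpoch a (q ^ 5) *
    qpoch (a * q) (q ^ 5) * qpoch (a * q ^ 2) (q ^ 5) * qpoch (a * q ^ 3) (q ^ 5)
    * qpoch (a * q ^ 4) (q ^ 5) := by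
  have := qp_split a hq 5
  simpa [Fin.prod_univ_five] using this

lemma qp_split3 (a : ℂ) {q : ℂ} (hq : ‖q‖ < 1) : qpoch a q = qpoch a (q ^ 3) *
    qpoch (a * q) (q ^ 3) * qpoch (a * q ^ 2) (q ^ 3) := by
  have := qp_split a hq 3
  simpa [Fin.prod_univ_three] using this

/-- `E(q) E(-q) E(q^4) = E(q^2)^3`. -/
lemma EE_neg {q : ℂ} (hq : ‖q‖ < 1) : EE q * EE (-q) * EE (q ^ 4) = EE (q ^ 2) ^ 3 := by
  have hq2 : ‖q ^ 2‖ < 1 := norm_pow_lt hq (by norm_num)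
  have h1 := EE_split2 hq
  have h2 := EE_split2 (q := -q) (by simpa using hq)
  have h3 := EE_split2 hq2
  have h4 := qp_neg q hq2
  rw [neg_sq] at h2
  rw [show (q ^ 2) ^ 2 = q ^ 4 by ring] at *
  rw [h1, h2]
  calc _ = (qpoch q (q ^ 2) * qpoch (-q) (q ^ 2)) * EE (q ^ 4) * EE (q ^ 2) ^ 2 := by ring
    _ = _ := by rw [h4, ← h3]; ring

lemma zeta5 {ζ : ℂ} (h : 1 + ζ + ζ ^ 2 + ζ ^ 3 + ζ ^ 4 = 0) : ζ ^ 5 = 1 := by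
  linear_combination (ζ - 1) * h

lemma zeta_norm {ζ : ℂ} (h : 1 + ζ + ζ ^ 2 + ζ ^ 3 + ζ ^ 4 = 0) : ‖ζ‖ = 1 := by
  have := congrArg norm (zeta5 h)
  rw [norm_pow, norm_one] at this
  exact (pow_eq_one_iff_of_nonneg (norm_nonneg _) (by norm_num)).1 this

lemma EE_five {ζ : ℂ} (h : 1 + ζ + ζ ^ 2 + ζ ^ 3 + ζ ^ 4 = 0) {q : ℂ} (hq : ‖q‖ < 1) :
    EE q * EE (ζ * q) * EE (ζ ^ 2 * q) * EE (ζ ^ 3 * q) * EE (ζ ^ 4 * q) * EE (q ^ 25)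
      = EE (q ^ 5) ^ 6 := by
  have h5 := zeta5 h
  have hn := zeta_norm h
  have hq5 : ‖q ^ 5‖ < 1 := norm_pow_lt hq (by norm_num)
  have hs : ∀ j : ℕ, EE (ζ ^ j * q) = qpoch (ζ ^ j * q) (q ^ 5) *
      qpoch (ζ ^ (2 * j) * q ^ 2) (q ^ 5) * qpoch (ζ ^ (3 * j) * q ^ 3) (q ^ 5)
      * qpoch (ζ ^ (4 * j) * q ^ 4) (q ^ 5) * EE (q ^ 5) := by
    intro j
    have hj : ‖ζ ^ j * q‖ < 1 := by simpa [hn] using hq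
    have e : (ζ ^ j * q) ^ 5 = q ^ 5 := by
      rw [mul_pow, ← pow_mul, mul_comm j 5, pow_mul, h5, one_pow, one_mul]
    have := qp_split5 (ζ ^ j * q) hj
    rw [e] at this
    rw [EE, this, EE, ← e]
    ring_nf
  have r1 := qp_five h q hq5
  have r2 := qp_five h (q ^ 2) hq5
  have r3 := qp_five h (q ^ 3) hq5
  have r4 := qp_five h (q ^ 4) hq5
  have s0 := hs 0
  have s1 := hs 1
  have s2 := hs 2
  have s3 := hs 3
  have s4 := hs 4
  have z6 : ζ ^ 6 = ζ := by linear_combination ζ * h5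
  have z8 : ζ ^ 8 = ζ ^ 3 := by linear_combination ζ ^ 3 * h5
  have z9 : ζ ^ 9 = ζ ^ 4 := by linear_combination ζ ^ 4 * h5
  have z12 : ζ ^ 12 = ζ ^ 2 := by linear_combination (ζ ^ 7 + ζ ^ 2) * h5
  have z16 : ζ ^ 16 = ζ := by linear_combination (ζ ^ 11 + ζ ^ 6 + ζ) * h5
  norm_num only at s0 s1 s2 s3 s4
  simp only [pow_zero, pow_one, one_mul, z6, z8, z9, z12, z16] at s0 s1 s2 s3 s4
  have t := qp_split5 (q ^ 5) hq5
  have t' : EE (q ^ 5) = qpoch (q ^ 5) ((q ^ 5) ^ 5) * qpoch ((q ^ 2) ^ 5) ((q ^ 5) ^ 5) *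
      qpoch ((q ^ 3) ^ 5) ((q ^ 5) ^ 5) * qpoch ((q ^ 4) ^ 5) ((q ^ 5) ^ 5) * EE (q ^ 25) := by
    rw [EE, t, EE]; ring_nf
  rw [← r1, ← r2, ← r3, ← r4] at t'
  rw [s0, s1, s2, s3, s4]
  linear_combination (-EE (q ^ 5) ^ 5) * t'

/-! ### The Jacobi triple product -/

/-- The theta series. -/
noncomputable def TT (p z : ℂ) : ℂ := ∑' n : ℤ, p ^ (n ^ 2) * z ^ n

lemma TT_summable {p z : ℂ} (hp0 : p ≠ 0) (hp : ‖p‖ < 1) (hz : z ≠ 0) :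
    Summable fun n : ℤ => p ^ (n ^ 2) * z ^ n := by
  have hpi : (Real.pi : ℂ) ≠ 0 := by exact_mod_cast Real.pi_ne_zero
  have h := (summable_jacobiTheta₂_term_iff (Complex.log z / (2 * Real.pi * Complex.I))
    (Complex.log p / (Real.pi * Complex.I))).2 (by
      have e : Complex.log p / (Real.pi * Complex.I) =
          ((1 / Real.pi : ℝ) : ℂ) * (-(Complex.I * Complex.log p)) := by
        push_cast
        field_simp
        rw [Complex.I_sq]; ring
      rw [e, Complex.im_ofReal_mul]
      have : 0 < -Real.log ‖p‖ := by
        have := Real.log_neg (norm_pos_iff.2 hp0) hp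
        linarith
      have h2 : (-(Complex.I * Complex.log p)).im = -Real.log ‖p‖ := by
        simp [Complex.mul_im, Complex.log_re]
      rw [h2]
      have := Real.pi_pos
      positivity)
  refine h.congr fun n => ?_
  rw [jacobiTheta₂_term, Complex.exp_add]
  have e1 : 2 * (Real.pi : ℂ) * Complex.I * n * (Complex.log z / (2 * Real.pi * Complex.I))
      = n * Complex.log z := by
    field_simp
  have e2 : (Real.pi : ℂ) * Complex.I * n ^ 2 * (Complex.log p / (Real.pi * Complex.I))
      = ((n ^ 2 : ℤ) : ℂ) * Complex.log p := by
    push_cast; field_simp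
  rw [e1, e2, Complex.exp_int_mul, Complex.exp_int_mul, Complex.exp_log hz, Complex.exp_log hp0,
    mul_comm]

/-- finite `(q;q)_k` -/
noncomputable def qf (q : ℂ) (k : ℕ) : ℂ := ∏ i ∈ Finset.range k, (1 - q * q ^ i)

lemma qf_ne {q : ℂ} (hq : ‖q‖ < 1) (k : ℕ) : qf q k ≠ 0 := by
  refine Finset.prod_ne_zero_iff.2 fun i _ h => ?_
  have h1 : q ^ (i + 1) = 1 := by rw [pow_succ]; linear_combination -h
  have h2 := norm_pow_lt hq (n := i + 1) (by omega)
  rw [h1] at h2; simp at h2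

lemma qf_tendsto {q : ℂ} (hq : ‖q‖ < 1) : Tendsto (qf q) atTop (𝓝 (EE q)) :=
  (qp_mult q hq).tendsto_prod_tprod_nat

/-- `1/(q;q)_k`, zero for negative `k`. -/
noncomputable def rr (q : ℂ) (k : ℤ) : ℂ := if k < 0 then 0 else (qf q k.toNat)⁻¹

lemma rr_rec {q : ℂ} (hq : ‖q‖ < 1) (k : ℤ) : rr q (k - 1) = (1 - q ^ k) * rr q k := by
  rcases lt_trichotomy k 0 with h | h | h
  · simp [rr, h, show k - 1 < 0 by omega]
  · subst h; simp [rr]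
  · obtain ⟨m, rfl⟩ : ∃ m : ℕ, k = m + 1 := ⟨(k - 1).toNat, by omega⟩
    have e1 : ((m : ℤ) + 1 - 1).toNat = m := by omega
    have e2 : ((m : ℤ) + 1).toNat = m + 1 := by omega
    rw [rr, rr, if_neg (by omega), if_neg (by omega), e1, e2]
    have h1 := qf_ne hq (m + 1)
    have h2 := qf_ne hq m
    have h3 : qf q (m + 1) = qf q m * (1 - q * q ^ m) := Finset.prod_range_succ _ _
    have h4 : q ^ ((m : ℤ) + 1) = q * q ^ m := by
      rw [show (m : ℤ) + 1 = ((m + 1 : ℕ) : ℤ) by push_cast; rfl, zpow_natCast, pow_succ]; ring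
    rw [h4]
    rw [h3] at h1 ⊢
    have h5 := right_ne_zero_of_mul h1
    field_simp

lemma rr_tendsto {q : ℂ} (hq : ‖q‖ < 1) (n : ℤ) :
    Tendsto (fun N : ℕ => rr q (N + n)) atTop (𝓝 (EE q)⁻¹) := by
  have h : Tendsto (fun N : ℕ => ((N : ℤ) + n).toNat) atTop atTop := by
    rw [tendsto_atTop]
    intro b
    filter_upwards [eventually_ge_atTop (b + n.natAbs)] with N hN
    omega
  refine (((qf_tendsto hq).inv₀ (EE_ne hq)).comp h).congr' ?_
  filter_upwards [eventually_ge_atTop n.natAbs] with N hN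
  simp only [Function.comp, rr]
  rw [if_neg (by omega)]

lemma bdd_of_tendsto {f : ℕ → ℂ} {a : ℂ} (h : Tendsto f atTop (𝓝 a)) : ∃ C : ℝ, ∀ n, ‖f n‖ ≤ C := by
  obtain ⟨C, hC⟩ := (h.norm).bddAbove_range
  exact ⟨C, fun n => hC ⟨n, rfl⟩⟩

noncomputable def cc (p z : ℂ) (N : ℕ) (n : ℤ) : ℂ :=
  qf (p ^ 2) (2 * N) * rr (p ^ 2) (N - n) * rr (p ^ 2) (N + n) * (p ^ (n ^ 2) * z ^ n)

lemma cc_rec {p z : ℂ} (hp0 : p ≠ 0) (hp : ‖p‖ < 1) (hz : z ≠ 0) (N : ℕ) (n : ℤ) :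
    cc p z (N + 1) n = (1 + p ^ (4 * N + 2)) * cc p z N n +
      p ^ (2 * N + 1) * (z * cc p z N (n - 1)) + p ^ (2 * N + 1) * (z⁻¹ * cc p z N (n + 1)) := by
  have hq : ‖p ^ 2‖ < 1 := norm_pow_lt hp (by norm_num)
  have hq0 : p ^ 2 ≠ 0 := pow_ne_zero _ hp0
  have a1 := rr_rec hq (N + 1 - n)
  have a2 := rr_rec hq (N - n)
  have b1 := rr_rec hq (N + 1 + n)
  have b2 := rr_rec hq (N + n)
  have f1 : qf (p ^ 2) (2 * (N + 1)) =
      qf (p ^ 2) (2 * N) * (1 - p ^ 2 * (p ^ 2) ^ (2 * N)) * (1 - p ^ 2 * (p ^ 2) ^ (2 * N + 1)) := by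
    unfold qf
    rw [show 2 * (N + 1) = 2 * N + 1 + 1 by ring, Finset.prod_range_succ, Finset.prod_range_succ]
  rw [show (N : ℤ) + 1 - n - 1 = N - n by ring] at a1
  rw [show (N : ℤ) + 1 + n - 1 = N + n by ring] at b1
  unfold cc
  rw [show (N : ℤ) - (n - 1) = N + 1 - n by ring, show (N : ℤ) - (n + 1) = N - n - 1 by ring,
    show (N : ℤ) + (n - 1) = N + n - 1 by ring, show (N : ℤ) + (n + 1) = N + 1 + n by ring,
    a2, b2, a1, b1, f1]
  push_cast
  set s := rr (p ^ 2) (N + 1 - n)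
  set t := rr (p ^ 2) (N + 1 + n)
  have c1 : p ^ ((n - 1) ^ 2) = p ^ (n ^ 2) * ((p ^ 2) ^ n)⁻¹ * p := by
    rw [show (n - 1) ^ 2 = n ^ 2 - 2 * n + 1 by ring, zpow_add₀ hp0, zpow_sub₀ hp0, zpow_mul]
    rw [zpow_one]; norm_cast
  have c2 : p ^ ((n + 1) ^ 2) = p ^ (n ^ 2) * ((p ^ 2) ^ n) * p := by
    rw [show (n + 1) ^ 2 = n ^ 2 + 2 * n + 1 by ring, zpow_add₀ hp0, zpow_add₀ hp0, zpow_mul]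
    rw [zpow_one]; norm_cast
  have c3 : z ^ (n - 1) = z ^ n * z⁻¹ := by rw [zpow_sub₀ hz, zpow_one]; rfl
  have c4 : z ^ (n + 1) = z ^ n * z := by rw [zpow_add₀ hz, zpow_one]
  rw [c1, c2, c3, c4]
  simp only [zpow_sub₀ hq0, zpow_add₀ hq0, zpow_one, zpow_natCast]
  have hy : (p ^ 2) ^ n ≠ 0 := zpow_ne_zero _ hq0
  set y := (p ^ 2) ^ n
  have g1 : p ^ (4 * N + 2) = (p ^ N) ^ 4 * p ^ 2 := by ring
  have g2 : p ^ (2 * N + 1) = (p ^ N) ^ 2 * p := by ring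
  have g3 : (p ^ 2) ^ N = (p ^ N) ^ 2 := by ring
  have g4 : (p ^ 2) ^ (2 * N) = (p ^ N) ^ 4 := by ring
  have g5 : (p ^ 2) ^ (2 * N + 1) = (p ^ N) ^ 4 * p ^ 2 := by ring
  rw [g1, g2, g3, g4, g5]
  generalize p ^ N = Q
  generalize p ^ (n ^ 2) = u
  generalize z ^ n = v
  generalize qf (p ^ 2) (2 * N) = w
  field_simp
  ring

lemma cc_hasSum {p z : ℂ} (hp0 : p ≠ 0) (hp : ‖p‖ < 1) (hz : z ≠ 0) (N : ℕ) :
    HasSum (cc p z N) (∏ k ∈ Finset.range N, ((1 - (-(z * p)) * (p ^ 2) ^ k) *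
      (1 - (-(p / z)) * (p ^ 2) ^ k))) := by
  induction N with
  | zero =>
    have : cc p z 0 0 = 1 := by simp [cc, rr, qf]
    rw [Finset.prod_range_zero, ← this]
    refine hasSum_single 0 fun n hn => ?_
    rcases lt_or_gt_of_ne hn with h | h
    · simp [cc, rr, h]
    · simp [cc, rr, h]
  | succ N ih =>
    have h1 := (Equiv.subRight (1 : ℤ)).hasSum_iff.2 ih
    have h2 := (Equiv.addRight (1 : ℤ)).hasSum_iff.2 ih
    have h := ((ih.mul_left (1 + p ^ (4 * N + 2))).add
      ((h1.mul_left z).mul_left (p ^ (2 * N + 1)))).add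
      ((h2.mul_left z⁻¹).mul_left (p ^ (2 * N + 1)))
    rw [funext (cc_rec hp0 hp hz N)]
    refine Eq.subst (motive := fun a => HasSum _ a) ?_ h
    rw [Finset.prod_range_succ]
    field_simp
    ring

theorem triple_product {p z : ℂ} (hp0 : p ≠ 0) (hp : ‖p‖ < 1) (hz : z ≠ 0) :
    TT p z = EE (p ^ 2) * qpoch (-(z * p)) (p ^ 2) * qpoch (-(p / z)) (p ^ 2) := by
  have hq : ‖p ^ 2‖ < 1 := norm_pow_lt hp (by norm_num)
  have hE := EE_ne hq
  obtain ⟨C1, hC1⟩ := bdd_of_tendsto (qf_tendsto hq)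
  obtain ⟨C2, hC2⟩ := bdd_of_tendsto ((qf_tendsto hq).inv₀ hE)
  have hC20 : 0 ≤ C2 := (norm_nonneg _).trans (hC2 0)
  have hC10 : 0 ≤ C1 := (norm_nonneg _).trans (hC1 0)
  have hr : ∀ k, ‖rr (p ^ 2) k‖ ≤ C2 := by
    intro k
    unfold rr
    split_ifs
    · simpa using hC20
    · exact hC2 _
  have lim1 : Tendsto (fun N => ∑' n, cc p z N n) atTop
      (𝓝 (∑' n : ℤ, (EE (p ^ 2) * (EE (p ^ 2))⁻¹ * (EE (p ^ 2))⁻¹ * (p ^ (n ^ 2) * z ^ n)))) := by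
    refine tendsto_tsum_of_dominated_convergence
      (bound := fun n : ℤ => C1 * C2 * C2 * ‖p ^ (n ^ 2) * z ^ n‖) ?_ ?_ ?_
    · exact (TT_summable hp0 hp hz).norm.mul_left _
    · intro n
      have t1 : Tendsto (fun N : ℕ => qf (p ^ 2) (2 * N)) atTop (𝓝 (EE (p ^ 2))) :=
        (qf_tendsto hq).comp (tendsto_id.const_mul_atTop' (by norm_num))
      have t2 := rr_tendsto hq (-n)
      have t3 := rr_tendsto hq n
      exact ((t1.mul t2).mul t3).mul_const _
    · refine Eventually.of_forall fun N n => ?_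
      unfold cc
      rw [norm_mul, norm_mul, norm_mul]
      gcongr
      · exact hC1 _
      · exact hr _
      · exact hr _
  have lim2 : Tendsto (fun N => ∑' n, cc p z N n) atTop
      (𝓝 (qpoch (-(z * p)) (p ^ 2) * qpoch (-(p / z)) (p ^ 2))) := by
    simp_rw [(cc_hasSum hp0 hp hz _).tsum_eq, Finset.prod_mul_distrib]
    exact (qp_mult _ hq).tendsto_prod_tprod_nat.mul (qp_mult _ hq).tendsto_prod_tprod_nat
  have := tendsto_nhds_unique lim1 lim2
  rw [tsum_mul_left, mul_inv_cancel₀ hE, one_mul] at this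
  rw [mul_assoc, ← this, TT, mul_inv_cancel_left₀ hE]

/-! ### Theta function identities -/

lemma TT_inv (p z : ℂ) : TT p z⁻¹ = TT p z := by
  unfold TT
  rw [← (Equiv.neg ℤ).tsum_eq]
  refine tsum_congr fun n => ?_
  simp

lemma TT_shift {p z w : ℂ} (hp0 : p ≠ 0) (hw : w ≠ 0) (h : z = p ^ 2 * w) :
    p * w * TT p z = TT p w := by
  subst h
  unfold TT
  rw [← (Equiv.addRight (1 : ℤ)).tsum_eq (fun n : ℤ => p ^ (n ^ 2) * w ^ n), ← tsum_mul_left]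
  refine tsum_congr fun n => ?_
  simp only [Equiv.coe_addRight]
  rw [show (n + 1) ^ 2 = n ^ 2 + 2 * n + 1 by ring, zpow_add₀ hp0, zpow_add₀ hp0, zpow_add₀ hw,
    mul_zpow, zpow_mul p 2 n, zpow_one, zpow_one]
  norm_cast
  ring

lemma TT_refl {p z w : ℂ} (hp0 : p ≠ 0) (hw : w ≠ 0) (h : z * w = p ^ 2) :
    p * TT p z = w * TT p w := by
  have := TT_shift (z := z) hp0 (inv_ne_zero hw) (by field_simp; exact h)
  rw [TT_inv] at this
  rw [← this]
  field_simp

lemma TT_zero {p z : ℂ} (hp0 : p ≠ 0) (hp : ‖p‖ < 1) (hz : z * p = -1) : TT p z = 0 := by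
  have hz0 : z ≠ 0 := by rintro rfl; simp at hz
  rw [triple_product hp0 hp hz0, hz]
  have : qpoch (- -1) (p ^ 2) = 0 := by
    unfold qpoch
    refine tprod_of_exists_eq_zero ⟨0, by simp⟩
  rw [this]; simp

lemma tsum_equiv_fin {α β : Type*} {m : ℕ} (e : Fin m × β ≃ α) (f : α → ℂ) (g : Fin m → β → ℂ)
    (hf : Summable f) (key : ∀ k b, f (e (k, b)) = g k b) (hg : ∀ k, Summable (g k)) :
    ∑' a, f a = ∑ k, ∑' b, g k b := by
  have h1 : Summable (f ∘ e) := e.summable_iff.2 hf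
  have h2 : (f ∘ e) = fun x : Fin m × β => g x.1 x.2 := funext fun x => key x.1 x.2
  have h3 : Summable fun x : Fin m × β => g x.1 x.2 := h2 ▸ h1
  rw [← e.tsum_eq f]
  refine (tsum_congr (fun x : Fin m × β => key x.1 x.2)).trans ?_
  rw [h3.tsum_prod' hg, tsum_fintype]

lemma TT_dissect {p z : ℂ} (hp0 : p ≠ 0) (hp : ‖p‖ < 1) (hz : z ≠ 0) (m : ℕ) [NeZero m] :
    TT p z = ∑ k : Fin m, p ^ ((k : ℕ) ^ 2) * z ^ (k : ℕ) *
      TT (p ^ (m ^ 2)) (p ^ (2 * m * (k : ℕ)) * z ^ m) := by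
  have hm : m ≠ 0 := NeZero.ne m
  set e : Fin m × ℤ ≃ ℤ := (Equiv.prodComm (Fin m) ℤ).trans (Int.divModEquiv m).symm with he
  have hs := TT_summable hp0 hp hz
  have key : ∀ (k : Fin m) (n : ℤ), p ^ ((e (k, n)) ^ 2) * z ^ (e (k, n)) =
      p ^ ((k : ℕ) ^ 2) * z ^ (k : ℕ) *
      ((p ^ (m ^ 2)) ^ (n ^ 2) * (p ^ (2 * m * (k : ℕ)) * z ^ m) ^ n) := by
    intro k n
    have : e (k, n) = m * n + (k : ℕ) := by
      simp [he, Int.divModEquiv_symm_apply]; ring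
    rw [this]
    simp only [mul_zpow, ← zpow_natCast, ← zpow_mul]
    rw [show ((m : ℤ) * n + (k : ℕ)) ^ 2 = ((k : ℕ) : ℤ) ^ 2 + (m : ℤ) ^ 2 * n ^ 2 +
      2 * m * (k : ℕ) * n by ring, zpow_add₀ hp0, zpow_add₀ hp0, zpow_add₀ hz]
    push_cast
    ring
  have hpm : ‖p ^ (m ^ 2)‖ < 1 := norm_pow_lt hp (pow_ne_zero _ hm)
  unfold TT
  rw [tsum_equiv_fin e _ _ hs key fun k => (TT_summable (pow_ne_zero _ hp0) hpm
    (mul_ne_zero (pow_ne_zero _ hp0) (pow_ne_zero _ hz))).mul_left _]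
  refine Finset.sum_congr rfl fun k _ => tsum_mul_left

/-- the lattice bijection coming from multiplication by `2 + i`. -/
def latEquiv : Fin 5 × (ℤ × ℤ) ≃ ℤ × ℤ where
  toFun x := (2 * x.2.1 + x.2.2 + (x.1 : ℕ), 2 * x.2.2 - x.2.1)
  invFun y := (⟨((y.1 + 2 * y.2) % 5).toNat, by omega⟩,
    (2 * ((y.1 + 2 * y.2) / 5) - y.2, (y.1 + 2 * y.2) / 5))
  left_inv := by
    rintro ⟨⟨k, hk⟩, m, n⟩
    simp only [Prod.mk.injEq, Fin.mk.injEq]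
    refine ⟨?_, ?_, ?_⟩ <;> omega
  right_inv := by
    rintro ⟨x, y⟩
    simp only [Prod.mk.injEq]
    constructor <;> omega

lemma TT_bilin {p z w : ℂ} (hp0 : p ≠ 0) (hp : ‖p‖ < 1) (hz : z ≠ 0) (hw : w ≠ 0) :
    TT p z * TT p w = ∑ k : Fin 5, p ^ ((k : ℕ) ^ 2) * z ^ (k : ℕ) *
      (TT (p ^ 5) (p ^ (4 * (k : ℕ)) * (z ^ 2 / w)) * TT (p ^ 5) (p ^ (2 * (k : ℕ)) * (z * w ^ 2))) := by
  have hp5 : ‖p ^ 5‖ < 1 := norm_pow_lt hp (by norm_num)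
  have hp50 : p ^ 5 ≠ 0 := pow_ne_zero _ hp0
  have s1 := (TT_summable hp0 hp hz).norm
  have s2 := (TT_summable hp0 hp hw).norm
  have hs := summable_mul_of_summable_norm s1 s2
  have key : ∀ (k : Fin 5) (x : ℤ × ℤ), p ^ ((latEquiv (k, x)).1 ^ 2) * z ^ (latEquiv (k, x)).1 *
      (p ^ ((latEquiv (k, x)).2 ^ 2) * w ^ (latEquiv (k, x)).2) =
      p ^ ((k : ℕ) ^ 2) * z ^ (k : ℕ) *
      (((p ^ 5) ^ (x.1 ^ 2) * (p ^ (4 * (k : ℕ)) * (z ^ 2 / w)) ^ x.1) *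
      ((p ^ 5) ^ (x.2 ^ 2) * (p ^ (2 * (k : ℕ)) * (z * w ^ 2)) ^ x.2)) := by
    rintro k ⟨m, n⟩
    simp only [latEquiv, Equiv.coe_fn_mk]
    simp only [mul_zpow, div_zpow, ← zpow_natCast, ← zpow_mul]
    generalize hk : ((k : ℕ) : ℤ) = K
    have A : p ^ ((2 * m + n + K) ^ 2) * p ^ ((2 * n - m) ^ 2) =
        p ^ (((k : ℕ) ^ 2 : ℕ) : ℤ) * p ^ (((5 : ℕ) : ℤ) * m ^ 2) *
          p ^ (((4 * (k : ℕ) : ℕ) : ℤ) * m) *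
        p ^ (((5 : ℕ) : ℤ) * n ^ 2) * p ^ (((2 * (k : ℕ) : ℕ) : ℤ) * n) := by
      simp only [← zpow_add₀ hp0]
      congr 1
      push_cast
      rw [hk]
      ring
    have B : z ^ (2 * m + n + K) = z ^ K * z ^ (((2 : ℕ) : ℤ) * m) * z ^ n := by
      simp only [← zpow_add₀ hz]
      congr 1
      push_cast
      ring
    have C : w ^ (2 * n - m) = w ^ (((2 : ℕ) : ℤ) * n) / w ^ m := by
      simp only [← zpow_sub₀ hw]
      congr 1
    rw [B, C]
    linear_combination (z ^ K * z ^ (((2 : ℕ) : ℤ) * m) * z ^ n *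
      (w ^ (((2 : ℕ) : ℤ) * n) / w ^ m)) * A
  have hz2 : z ^ 2 / w ≠ 0 := div_ne_zero (pow_ne_zero _ hz) hw
  have hw2 : z * w ^ 2 ≠ 0 := mul_ne_zero hz (pow_ne_zero _ hw)
  have t1 : ∀ k : ℕ, Summable fun n : ℤ => (p ^ 5) ^ (n ^ 2) * (p ^ (4 * k) * (z ^ 2 / w)) ^ n :=
    fun k => TT_summable hp50 hp5 (mul_ne_zero (pow_ne_zero _ hp0) hz2)
  have t2 : ∀ k : ℕ, Summable fun n : ℤ => (p ^ 5) ^ (n ^ 2) * (p ^ (2 * k) * (z * w ^ 2)) ^ n :=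
    fun k => TT_summable hp50 hp5 (mul_ne_zero (pow_ne_zero _ hp0) hw2)
  unfold TT
  rw [tsum_mul_tsum_of_summable_norm s1 s2, tsum_equiv_fin latEquiv _ _ hs key fun k =>
    (summable_mul_of_summable_norm (t1 k).norm (t2 k).norm).mul_left _]
  refine Finset.sum_congr rfl fun k _ => ?_
  rw [tsum_mul_tsum_of_summable_norm (t1 k).norm (t2 k).norm]
  exact tsum_mul_left

/-! ### Product evaluations of theta functions -/

lemma Psi_prod {q : ℂ} (hq0 : q ≠ 0) (hq : ‖q‖ < 1) :
    TT (q ^ 2) q * EE q = EE (q ^ 2) ^ 2 := by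
  have hq2 : ‖q ^ 2‖ < 1 := norm_pow_lt hq (by norm_num)
  have h1 := triple_product (p := q ^ 2) (z := q) (pow_ne_zero _ hq0) hq2 hq0
  have h2 := qp_split (-q) hq2 2
  have h3 := qp_neg q hq2
  have h4 := EE_split2 hq
  have h5 := EE_split2 hq2
  simp only [Fin.prod_univ_two, Fin.val_zero, Fin.val_one, pow_zero, mul_one, pow_one] at h2
  rw [show -(q * q ^ 2) = -q * q ^ 2 by ring, show q ^ 2 / q = q by field_simp] at h1
  rw [h1, h4]
  have h6 : EE (q ^ 2) = qpoch q (q ^ 2) * (qpoch (-q) ((q ^ 2) ^ 2) * qpoch (-q * q ^ 2) ((q ^ 2) ^ 2)) * EE ((q ^ 2) ^ 2) := by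
    rw [← h2, h3, ← h5]
  linear_combination (-EE (q ^ 2)) * h6

lemma Phi_prod {q : ℂ} (hq0 : q ≠ 0) (hq : ‖q‖ < 1) :
    TT q (-1) * EE (q ^ 2) = EE q ^ 2 := by
  have h1 := triple_product (p := q) (z := -1) hq0 hq (by norm_num)
  rw [show -(-1 * q) = q by ring, show -(q / -1) = q by ring] at h1
  rw [h1, EE_split2 hq]
  ring

lemma XY_prod {s : ℂ} (hs0 : s ≠ 0) (hs : ‖s‖ < 1) :
    TT (s ^ 5) s * TT (s ^ 5) (s ^ 3) * EE (s ^ 2) * EE (s ^ 20) = EE (s ^ 10) ^ 3 * EE (s ^ 4) := by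
  have n2 : ‖s ^ 2‖ < 1 := norm_pow_lt hs (by norm_num)
  have n5 : ‖s ^ 5‖ < 1 := norm_pow_lt hs (by norm_num)
  have n10 : ‖s ^ 10‖ < 1 := norm_pow_lt hs (by norm_num)
  have h1 := triple_product (p := s ^ 5) (z := s) (pow_ne_zero _ hs0) n5 hs0
  have h2 := triple_product (p := s ^ 5) (z := s ^ 3) (pow_ne_zero _ hs0) n5 (pow_ne_zero _ hs0)
  have h3 := qp_split5 (-s ^ 2) n2
  have h4 := qp_neg (s ^ 2) n2
  have h5 := qp_neg (s ^ 10) n10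
  rw [show -(s * s ^ 5) = -s ^ 6 by ring, show s ^ 5 / s = s ^ 4 by field_simp,
    show (s ^ 5) ^ 2 = s ^ 10 by ring] at h1
  rw [show -(s ^ 3 * s ^ 5) = -s ^ 8 by ring, show s ^ 5 / s ^ 3 = s ^ 2 by field_simp,
    show (s ^ 5) ^ 2 = s ^ 10 by ring] at h2
  rw [show (s ^ 2) ^ 5 = s ^ 10 by ring, show -s ^ 2 * s ^ 2 = -s ^ 4 by ring,
    show -s ^ 2 * (s ^ 2) ^ 2 = -s ^ 6 by ring, show -s ^ 2 * (s ^ 2) ^ 3 = -s ^ 8 by ring,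
    show -s ^ 2 * (s ^ 2) ^ 4 = -s ^ 10 by ring] at h3
  rw [h3, show (s ^ 2) ^ 2 = s ^ 4 by ring] at h4
  rw [show (s ^ 10) ^ 2 = s ^ 20 by ring] at h5
  rw [h1, h2]
  unfold EE
  rw [← h4, ← h5]
  ring

lemma ff_prod {q : ℂ} (hq0 : q ≠ 0) (hq : ‖q‖ < 1) :
    TT (q ^ 5) (-q ^ 4) * TT (q ^ 5) (-q ^ 2) * EE (q ^ 2) * EE (q ^ 5) = EE q * EE (q ^ 10) ^ 3 := by
  have n2 : ‖q ^ 2‖ < 1 := norm_pow_lt hq (by norm_num)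
  have n5 : ‖q ^ 5‖ < 1 := norm_pow_lt hq (by norm_num)
  have h1 := triple_product (p := q ^ 5) (z := -q ^ 4) (pow_ne_zero _ hq0) n5
    (neg_ne_zero.2 (pow_ne_zero _ hq0))
  have h2 := triple_product (p := q ^ 5) (z := -q ^ 2) (pow_ne_zero _ hq0) n5
    (neg_ne_zero.2 (pow_ne_zero _ hq0))
  have h3 := qp_split5 q n2
  have h4 := EE_split2 hq
  have h5 := EE_split2 n5
  rw [show -(-q ^ 4 * q ^ 5) = q ^ 9 by ring, show -(q ^ 5 / -q ^ 4) = q by field_simp,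
    show (q ^ 5) ^ 2 = q ^ 10 by ring] at h1
  rw [show -(-q ^ 2 * q ^ 5) = q ^ 7 by ring, show -(q ^ 5 / -q ^ 2) = q ^ 3 by field_simp,
    show (q ^ 5) ^ 2 = q ^ 10 by ring] at h2
  rw [show (q ^ 2) ^ 5 = q ^ 10 by ring, show q * q ^ 2 = q ^ 3 by ring,
    show q * (q ^ 2) ^ 2 = q ^ 5 by ring, show q * (q ^ 2) ^ 3 = q ^ 7 by ring,
    show q * (q ^ 2) ^ 4 = q ^ 9 by ring] at h3
  rw [show (q ^ 5) ^ 2 = q ^ 10 by ring] at h5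
  rw [h1, h2, h4, h5, h3]
  ring

/-! ### Two quadratic identities -/

lemma TTr {q : ℂ} (hq0 : q ≠ 0) (n i j : ℕ) (h : i + j = n) :
    q ^ i * TT (q ^ n) (q ^ (n + i)) = TT (q ^ n) (q ^ j) := by
  have := TT_refl (p := q ^ n) (z := q ^ (n + i)) (w := q ^ j) (pow_ne_zero _ hq0)
    (pow_ne_zero _ hq0) (by rw [← pow_add, ← pow_mul]; congr 1; omega)
  apply mul_left_cancel₀ (pow_ne_zero j hq0)
  rw [← this, ← mul_assoc, ← pow_add, add_comm j, h]

lemma TTr_neg {q : ℂ} (hq0 : q ≠ 0) (n i j : ℕ) (h : i + j = n) :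
    q ^ i * TT (q ^ n) (-q ^ (n + i)) = -TT (q ^ n) (-q ^ j) := by
  have := TT_refl (p := q ^ n) (z := -q ^ (n + i)) (w := -q ^ j) (pow_ne_zero _ hq0)
    (neg_ne_zero.2 (pow_ne_zero _ hq0))
    (by rw [neg_mul_neg, ← pow_add, ← pow_mul]; congr 1; omega)
  apply mul_left_cancel₀ (pow_ne_zero j hq0)
  rw [mul_neg, ← neg_mul, ← this, ← mul_assoc, ← pow_add, add_comm j, h]

lemma TTs {q : ℂ} (hq0 : q ≠ 0) (n i : ℕ) :
    q ^ (n + i) * TT (q ^ n) (q ^ (2 * n + i)) = TT (q ^ n) (q ^ i) := by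
  have := TT_shift (p := q ^ n) (z := q ^ (2 * n + i)) (w := q ^ i) (pow_ne_zero _ hq0)
    (pow_ne_zero _ hq0) (by rw [← pow_mul, ← pow_add]; congr 1; omega)
  rw [← this, pow_add]

lemma TTs_neg {q : ℂ} (hq0 : q ≠ 0) (n i : ℕ) :
    q ^ (n + i) * TT (q ^ n) (-q ^ (2 * n + i)) = -TT (q ^ n) (-q ^ i) := by
  have := TT_shift (p := q ^ n) (z := -q ^ (2 * n + i)) (w := -q ^ i) (pow_ne_zero _ hq0)
    (neg_ne_zero.2 (pow_ne_zero _ hq0)) (by rw [mul_neg, ← pow_mul, ← pow_add]; congr 2; omega)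
  rw [← this, pow_add]
  ring

lemma quadI {s : ℂ} (hs0 : s ≠ 0) (hs : ‖s‖ < 1) :
    TT (s ^ 4) (s ^ 2) ^ 2 = TT (s ^ 5) s * TT (s ^ 5) (s ^ 3) + s ^ 2 * TT (s ^ 20) (s ^ 10) ^ 2 := by
  obtain ⟨q, hqs⟩ : ∃ q, q = s ^ 2 := ⟨_, rfl⟩
  have hq0 : q ≠ 0 := hqs ▸ pow_ne_zero _ hs0
  have hq : ‖q‖ < 1 := hqs ▸ norm_pow_lt hs (by norm_num)
  have n5 : ‖s ^ 5‖ < 1 := norm_pow_lt hs (by norm_num)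
  have n2 : ‖q ^ 2‖ < 1 := norm_pow_lt hq (by norm_num)
  have hX := TT_dissect (p := s ^ 5) (z := s) (pow_ne_zero _ hs0) n5 hs0 2
  have hY := TT_dissect (p := s ^ 5) (z := s ^ 3) (pow_ne_zero _ hs0) n5 (pow_ne_zero _ hs0) 2
  have hB := TT_bilin (p := q ^ 2) (z := q) (w := q) (pow_ne_zero _ hq0) n2 hq0 hq0
  simp only [Fin.sum_univ_two, Fin.val_zero, Fin.val_one] at hX hY
  simp only [Fin.sum_univ_five, Fin.val_zero, Fin.val_one, Fin.val_two,
    show ((3 : Fin 5) : ℕ) = 3 from rfl, show ((4 : Fin 5) : ℕ) = 4 from rfl] at hB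
  rw [show (s ^ 5) ^ 2 ^ 2 = q ^ 10 by rw [hqs]; ring,
    show (s ^ 5) ^ (2 * 2 * 0) * s ^ 2 = q ^ 1 by rw [hqs]; ring,
    show (s ^ 5) ^ (2 * 2 * 1) * s ^ 2 = q ^ 11 by rw [hqs]; ring,
    show (s ^ 5) ^ (1 ^ 2) * s ^ 1 = q ^ 3 by rw [hqs]; ring] at hX
  rw [show (s ^ 5) ^ 2 ^ 2 = q ^ 10 by rw [hqs]; ring,
    show (s ^ 5) ^ (2 * 2 * 0) * (s ^ 3) ^ 2 = q ^ 3 by rw [hqs]; ring,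
    show (s ^ 5) ^ (2 * 2 * 1) * (s ^ 3) ^ 2 = q ^ 13 by rw [hqs]; ring,
    show (s ^ 5) ^ (1 ^ 2) * (s ^ 3) ^ 1 = q ^ 4 by rw [hqs]; ring] at hY
  rw [show q ^ 2 / q = q by field_simp, show (q ^ 2) ^ 5 = q ^ 10 by ring,
    show (q ^ 2) ^ (4 * 0) * q = q ^ 1 by ring, show (q ^ 2) ^ (4 * 1) * q = q ^ 9 by ring,
    show (q ^ 2) ^ (4 * 2) * q = q ^ 17 by ring, show (q ^ 2) ^ (4 * 3) * q = q ^ 25 by ring,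
    show (q ^ 2) ^ (4 * 4) * q = q ^ 33 by ring,
    show (q ^ 2) ^ (2 * 0) * (q * q ^ 2) = q ^ 3 by ring,
    show (q ^ 2) ^ (2 * 1) * (q * q ^ 2) = q ^ 7 by ring,
    show (q ^ 2) ^ (2 * 2) * (q * q ^ 2) = q ^ 11 by ring,
    show (q ^ 2) ^ (2 * 3) * (q * q ^ 2) = q ^ 15 by ring,
    show (q ^ 2) ^ (2 * 4) * (q * q ^ 2) = q ^ 19 by ring] at hB
  rw [show s ^ 4 = q ^ 2 by rw [hqs]; ring, show s ^ 20 = q ^ 10 by rw [hqs]; ring,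
    show s ^ 10 = q ^ 5 by rw [hqs]; ring, ← hqs, sq (TT (q ^ 2) q), hX, hY, hB]
  have r17 := TTr hq0 10 7 3 rfl
  have r11 := TTr hq0 10 1 9 rfl
  have r15 := TTr hq0 10 5 5 rfl
  have r19 := TTr hq0 10 9 1 rfl
  have r13 := TTr hq0 10 3 7 rfl
  have s25 := TTs hq0 10 5
  have s33 := TTs hq0 10 13
  norm_num at r17 r11 r15 r19 r13 s25 s33 ⊢
  rw [← r19, ← r17, ← r11, ← r13, ← s33]
  have e5 : TT (q ^ 10) (q ^ 5) ^ 2 = (q ^ 15 * TT (q ^ 10) (q ^ 25)) * (q ^ 5 * TT (q ^ 10) (q ^ 15)) := by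
    rw [s25, r15]; ring
  rw [e5]
  ring

lemma quadII {q : ℂ} (hq0 : q ≠ 0) (hq : ‖q‖ < 1) :
    TT q (-1) ^ 2 = TT (q ^ 5) (-1) ^ 2 -
      4 * q * (TT (q ^ 5) (-q ^ 4) * TT (q ^ 5) (-q ^ 2)) := by
  have hB := TT_bilin (p := q) (z := -1) (w := -1) hq0 hq (by norm_num) (by norm_num)
  simp only [Fin.sum_univ_five, Fin.val_zero, Fin.val_one, Fin.val_two,
    show ((3 : Fin 5) : ℕ) = 3 from rfl, show ((4 : Fin 5) : ℕ) = 4 from rfl] at hB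
  have r8 := TTr_neg hq0 5 3 2 rfl
  have r6 := TTr_neg hq0 5 1 4 rfl
  have s12 := TTs_neg hq0 5 2
  have s16 := TTs_neg hq0 5 6
  norm_num at r8 r6 s12 s16 hB
  rw [sq, hB]
  linear_combination (q * TT (q ^ 5) (-q ^ 4)) * r8 - q ^ 2 * TT (q ^ 5) (-q ^ 6) * s12
    + (q ^ 5 * TT (q ^ 5) (-q ^ 8)) * s16 + 2 * q * TT (q ^ 5) (-q ^ 2) * r6
    - q ^ 2 * TT (q ^ 5) (-q ^ 6) * r8

/-! ### Eta quotient identities of level 10 -/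

lemma etaI {q : ℂ} (hq0 : q ≠ 0) (hq : ‖q‖ < 1) :
    EE (q ^ 2) ^ 4 * EE (q ^ 5) ^ 2 * EE (q ^ 10) =
      EE q * EE (q ^ 2) * EE (q ^ 5) ^ 5 + q * EE q ^ 2 * EE (q ^ 10) ^ 5 := by
  obtain ⟨s, hs⟩ : ∃ s : ℂ, s ^ 2 = q := IsAlgClosed.exists_pow_nat_eq q (by norm_num)
  have hs0 : s ≠ 0 := by rintro rfl; apply hq0; rw [← hs]; norm_num
  have hs1 : ‖s‖ < 1 := by
    rw [← hs, norm_pow] at hq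
    exact (pow_lt_one_iff_of_nonneg (norm_nonneg _) (by norm_num)).1 hq
  have n5 : ‖q ^ 5‖ < 1 := norm_pow_lt hq (by norm_num)
  have h1 := quadI hs0 hs1
  have h2 := XY_prod hs0 hs1
  have h3 := Psi_prod hq0 hq
  have h4 := Psi_prod (pow_ne_zero 5 hq0) n5
  rw [show (q ^ 5) ^ 2 = q ^ 10 by ring] at h4
  rw [show s ^ 4 = q ^ 2 by rw [← hs]; ring, show s ^ 20 = q ^ 10 by rw [← hs]; ring,
    show s ^ 10 = q ^ 5 by rw [← hs]; ring, hs] at h1 h2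
  have h3' : (TT (q ^ 2) q * EE q) ^ 2 = EE (q ^ 2) ^ 4 := by rw [h3]; ring
  have h4' : (TT (q ^ 10) (q ^ 5) * EE (q ^ 5)) ^ 2 = EE (q ^ 10) ^ 4 := by rw [h4]; ring
  linear_combination (EE q ^ 2 * EE (q ^ 10) * EE (q ^ 5) ^ 2) * h1
    - EE (q ^ 5) ^ 2 * EE (q ^ 10) * h3' + EE q * EE (q ^ 5) ^ 2 * h2 +
    q * EE q ^ 2 * EE (q ^ 10) * h4'

lemma etaII {q : ℂ} (hq0 : q ≠ 0) (hq : ‖q‖ < 1) :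
    EE q ^ 4 * EE (q ^ 10) ^ 2 * EE (q ^ 5) =
      EE (q ^ 5) ^ 5 * EE (q ^ 2) ^ 2 - 4 * q * EE q * EE (q ^ 10) ^ 5 * EE (q ^ 2) := by
  have n5 : ‖q ^ 5‖ < 1 := norm_pow_lt hq (by norm_num)
  have h1 := quadII hq0 hq
  have h2 := ff_prod hq0 hq
  have h3 := Phi_prod hq0 hq
  have h4 := Phi_prod (pow_ne_zero 5 hq0) n5
  rw [show (q ^ 5) ^ 2 = q ^ 10 by ring] at h4
  have h3' : (TT q (-1) * EE (q ^ 2)) ^ 2 = EE q ^ 4 := by rw [h3]; ring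
  have h4' : (TT (q ^ 5) (-1) * EE (q ^ 10)) ^ 2 = EE (q ^ 5) ^ 4 := by rw [h4]; ring
  linear_combination (EE (q ^ 2) ^ 2 * EE (q ^ 10) ^ 2 * EE (q ^ 5)) * h1
    - EE (q ^ 5) * EE (q ^ 10) ^ 2 * h3' - 4 * q * EE (q ^ 2) * EE (q ^ 10) ^ 2 * h2 +
    EE (q ^ 2) ^ 2 * EE (q ^ 5) * h4'

noncomputable def Cf (q : ℂ) : ℂ := EE (q ^ 5) ^ 5 / EE q

noncomputable def Df (q : ℂ) : ℂ := EE q ^ 5 / EE (q ^ 5)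

noncomputable def Bf (q : ℂ) : ℂ := psiNeg (q ^ 5) ^ 5 / psiNeg q

lemma psiNeg_neg {q : ℂ} (hq : ‖q‖ < 1) : psiNeg (-q) = EE (q ^ 2) ^ 2 / EE q := by
  have h := EE_neg hq
  have h1 := EE_ne hq
  have h2 := EE_ne (norm_pow_lt hq (n := 2) (by norm_num))
  have : psiNeg (-q) = EE (-q) * EE (q ^ 4) / EE (q ^ 2) := by
    unfold psiNeg EE
    rw [show (-q) ^ 4 = q ^ 4 by ring, show (-q) ^ 2 = q ^ 2 by ring]
  rw [this, div_eq_div_iff h2 h1]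
  linear_combination h

lemma etaIII {q : ℂ} (hq0 : q ≠ 0) (hq : ‖q‖ < 1) :
    20 * q ^ 3 * Bf (-q) = 5 * q * Cf q - 15 * q ^ 2 * Cf (q ^ 2) + Df q - Df (q ^ 2) := by
  have n2 : ‖q ^ 2‖ < 1 := norm_pow_lt hq (by norm_num)
  have n5 : ‖q ^ 5‖ < 1 := norm_pow_lt hq (by norm_num)
  have n10 : ‖q ^ 10‖ < 1 := norm_pow_lt hq (by norm_num)
  have hI := etaI hq0 hq
  have hII := etaII hq0 hq
  have e1 := EE_ne hq
  have e2 := EE_ne n2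
  have e5 := EE_ne n5
  have e10 := EE_ne n10
  unfold Bf Cf Df
  rw [show (-q) ^ 5 = -q ^ 5 by ring, psiNeg_neg hq, psiNeg_neg n5,
    show (q ^ 5) ^ 2 = q ^ 10 by ring, show (q ^ 2) ^ 5 = q ^ 10 by ring]
  generalize EE q = A at *
  generalize EE (q ^ 2) = B at *
  generalize EE (q ^ 5) = C at *
  generalize EE (q ^ 10) = D at *
  clear n2 n5 n10 hq
  have key : 20 * q ^ 3 * D ^ 11 * A ^ 2 = 5 * q * B ^ 2 * C ^ 10 * D - 15 * q ^ 2 * A * B * C ^ 5 * D ^ 6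
      + A ^ 6 * B ^ 2 * C ^ 4 * D - A * B ^ 7 * C ^ 5 := by
    apply mul_left_cancel₀ (mul_ne_zero (pow_ne_zero 4 e1) (pow_ne_zero 4 e10))
    obtain ⟨α, hα⟩ : ∃ α, α = B ^ 4 * C ^ 2 * D := ⟨_, rfl⟩
    obtain ⟨β, hβ⟩ : ∃ β, β = A * B * C ^ 5 := ⟨_, rfl⟩
    obtain ⟨γ, hγ⟩ : ∃ γ, γ = q * A ^ 2 * D ^ 5 := ⟨_, rfl⟩
    have k1 : α = β + γ := by rw [hα, hβ, hγ, hI]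
    have k2 : A ^ 5 * C * D ^ 2 = B * (β - 4 * γ) := by
      rw [hβ, hγ]; linear_combination A * hII
    have t1 : A ^ 4 * D ^ 4 * (A ^ 6 * B ^ 2 * C ^ 4 * D) = α * (β - 4 * γ) ^ 2 := by
      calc _ = (A ^ 5 * C * D ^ 2) ^ 2 * (B ^ 2 * C ^ 2 * D) := by ring
        _ = _ := by rw [k2, hα]; ring
    have t2 : A ^ 4 * D ^ 4 * (A * B ^ 7 * C ^ 5) = α ^ 2 * (β - 4 * γ) := by
      calc _ = (A ^ 5 * C * D ^ 2) * (B ^ 7 * C ^ 4 * D ^ 2) := by ring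
        _ = _ := by rw [k2, hα]; ring
    have t3 : A ^ 4 * D ^ 4 * (20 * q ^ 3 * D ^ 11 * A ^ 2) = 20 * γ ^ 3 := by rw [hγ]; ring
    have t4 : A ^ 4 * D ^ 4 * (5 * q * B ^ 2 * C ^ 10 * D) = 5 * γ * β ^ 2 := by rw [hγ, hβ]; ring
    have t5 : A ^ 4 * D ^ 4 * (15 * q ^ 2 * A * B * C ^ 5 * D ^ 6) = 15 * γ ^ 2 * β := by
      rw [hγ, hβ]; ring
    rw [mul_sub, mul_add, mul_sub, t1, t2, t3, t4, t5, k1]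
    ring
  field_simp
  linear_combination key

lemma etaIV {q : ℂ} (hq0 : q ≠ 0) (hq : ‖q‖ < 1) :
    20 * q ^ 3 * (Bf q + Bf (-q)) = 5 * q * (Cf q + Cf (-q)) + Df q - Df (-q) := by
  have h1 := etaIII hq0 hq
  have h2 := etaIII (q := -q) (neg_ne_zero.2 hq0) (by simpa using hq)
  rw [neg_neg, neg_sq] at h2
  linear_combination h1 - h2

/-! ### The 5-dissection of the Euler product -/

lemma pent {s : ℂ} (hs0 : s ≠ 0) (hs : ‖s‖ < 1) : EE (s ^ 2) = TT (s ^ 3) (-s) := by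
  have n2 : ‖s ^ 2‖ < 1 := norm_pow_lt hs (by norm_num)
  have n3 : ‖s ^ 3‖ < 1 := norm_pow_lt hs (by norm_num)
  have h1 := triple_product (p := s ^ 3) (z := -s) (pow_ne_zero _ hs0) n3 (neg_ne_zero.2 hs0)
  have h2 := qp_split3 (s ^ 2) n2
  rw [show -(-s * s ^ 3) = s ^ 4 by ring, show -(s ^ 3 / -s) = s ^ 2 by field_simp,
    show (s ^ 3) ^ 2 = s ^ 6 by ring] at h1
  rw [show (s ^ 2) ^ 3 = s ^ 6 by ring, show s ^ 2 * s ^ 2 = s ^ 4 by ring,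
    show s ^ 2 * (s ^ 2) ^ 2 = s ^ 6 by ring] at h2
  rw [h1, EE, h2, EE]
  ring

noncomputable def av (t : ℂ) : ℂ := TT (t ^ 15) (-t ^ 1) - t ^ 6 * TT (t ^ 15) (-t ^ 19)

noncomputable def cv (t : ℂ) : ℂ := -TT (t ^ 15) (-t ^ 7) + t ^ 2 * TT (t ^ 15) (-t ^ 13)

lemma pent_b {t : ℂ} (ht0 : t ≠ 0) (ht : ‖t‖ < 1) : EE (t ^ 10) = TT (t ^ 15) (-t ^ 5) := by
  have := pent (s := t ^ 5) (pow_ne_zero _ ht0) (norm_pow_lt ht (by norm_num))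
  rwa [show (t ^ 5) ^ 2 = t ^ 10 by ring, show (t ^ 5) ^ 3 = t ^ 15 by ring] at this

lemma pent_dis {s : ℂ} (hs0 : s ≠ 0) (hs : ‖s‖ < 1) :
    EE (s ^ 2) = av (s ^ 5) - s ^ 2 * EE (s ^ 50) + s ^ 4 * cv (s ^ 5) := by
  have n3 : ‖s ^ 3‖ < 1 := norm_pow_lt hs (by norm_num)
  have n5 : ‖s ^ 5‖ < 1 := norm_pow_lt hs (by norm_num)
  have h0 := pent_b (pow_ne_zero 5 hs0) n5
  have h1 := TT_dissect (p := s ^ 3) (z := -s) (pow_ne_zero _ hs0) n3 (neg_ne_zero.2 hs0) 5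
  have h2 := TTr_neg (pow_ne_zero 5 hs0) 15 10 5 rfl
  simp only [Fin.sum_univ_five, Fin.val_zero, Fin.val_one, Fin.val_two,
    show ((3 : Fin 5) : ℕ) = 3 from rfl, show ((4 : Fin 5) : ℕ) = 4 from rfl] at h1
  rw [show (s ^ 3) ^ 5 ^ 2 = (s ^ 5) ^ 15 by ring,
    show (s ^ 3) ^ (2 * 5 * 0) * (-s) ^ 5 = -(s ^ 5) ^ 1 by ring,
    show (s ^ 3) ^ (2 * 5 * 1) * (-s) ^ 5 = -(s ^ 5) ^ 7 by ring,
    show (s ^ 3) ^ (2 * 5 * 2) * (-s) ^ 5 = -(s ^ 5) ^ 13 by ring,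
    show (s ^ 3) ^ (2 * 5 * 3) * (-s) ^ 5 = -(s ^ 5) ^ 19 by ring,
    show (s ^ 3) ^ (2 * 5 * 4) * (-s) ^ 5 = -(s ^ 5) ^ (15 + 10) by ring] at h1
  rw [show (s ^ 5) ^ 10 = s ^ 50 by ring] at h0
  rw [pent hs0 hs, h1, h0, av, cv]
  linear_combination s ^ 2 * h2

lemma av_cv {t : ℂ} (ht0 : t ≠ 0) (ht : ‖t‖ < 1) : av t * cv t = -EE (t ^ 10) ^ 2 := by
  have n3 : ‖t ^ 3‖ < 1 := norm_pow_lt ht (by norm_num)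
  have hB := TT_bilin (p := t ^ 3) (z := -t⁻¹) (w := -(t ^ 3)⁻¹) (pow_ne_zero _ ht0) n3
    (neg_ne_zero.2 (inv_ne_zero ht0)) (neg_ne_zero.2 (inv_ne_zero (pow_ne_zero _ ht0)))
  rw [TT_zero (z := -(t ^ 3)⁻¹) (pow_ne_zero _ ht0) n3 (by field_simp)] at hB
  simp only [Fin.sum_univ_five, Fin.val_zero, Fin.val_one, Fin.val_two,
    show ((3 : Fin 5) : ℕ) = 3 from rfl, show ((4 : Fin 5) : ℕ) = 4 from rfl] at hB
  rw [show (-t⁻¹) ^ 2 / -(t ^ 3)⁻¹ = -t by field_simp,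
    show (-t⁻¹) * (-(t ^ 3)⁻¹) ^ 2 = -(t ^ 7)⁻¹ by field_simp,
    show (t ^ 3) ^ 5 = t ^ 15 by ring,
    show (t ^ 3) ^ (4 * 0) * -t = -t ^ 1 by ring,
    show (t ^ 3) ^ (4 * 1) * -t = -t ^ 13 by ring,
    show (t ^ 3) ^ (4 * 2) * -t = -t ^ (15 + 10) by ring,
    show (t ^ 3) ^ (4 * 3) * -t = -t ^ (2 * 15 + 7) by ring,
    show (t ^ 3) ^ (4 * 4) * -t = -t ^ (2 * 15 + 19) by ring,
    show (t ^ 3) ^ (2 * 0) * -(t ^ 7)⁻¹ = (-t ^ 7)⁻¹ by field_simp; ring,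
    show (t ^ 3) ^ (2 * 1) * -(t ^ 7)⁻¹ = (-t ^ 1)⁻¹ by field_simp; ring,
    show (t ^ 3) ^ (2 * 2) * -(t ^ 7)⁻¹ = -t ^ 5 by field_simp; ring,
    show (t ^ 3) ^ (2 * 3) * -(t ^ 7)⁻¹ = -t ^ 11 by field_simp; ring,
    show (t ^ 3) ^ (2 * 4) * -(t ^ 7)⁻¹ = -t ^ (15 + 2) by field_simp; ring,
    TT_inv, TT_inv,
    show (t ^ 3) ^ 0 ^ 2 * (-t⁻¹) ^ 0 = 1 by ring,
    show (t ^ 3) ^ 1 ^ 2 * (-t⁻¹) ^ 1 = -t ^ 2 by field_simp; ring,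
    show (t ^ 3) ^ 2 ^ 2 * (-t⁻¹) ^ 2 = t ^ 10 by field_simp; ring,
    show (t ^ 3) ^ 3 ^ 2 * (-t⁻¹) ^ 3 = -t ^ 24 by field_simp; ring,
    show (t ^ 3) ^ 4 ^ 2 * (-t⁻¹) ^ 4 = t ^ 44 by field_simp; ring] at hB
  have r25 := TTr_neg ht0 15 10 5 rfl
  have r17 := TTr_neg ht0 15 2 13 rfl
  have r19 := TTr_neg ht0 15 4 11 rfl
  have s37 := TTs_neg ht0 15 7
  have s49 := TTs_neg ht0 15 19
  rw [av, cv, pent_b ht0 ht]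
  norm_num at *
  generalize TT (t ^ 15) (-t ^ 37) = T37 at *
  generalize TT (t ^ 15) (-t ^ 49) = T49 at *
  generalize TT (t ^ 15) (-t ^ 25) = T25 at *
  generalize TT (t ^ 15) (-t ^ 17) = T17 at *
  generalize TT (t ^ 15) (-t ^ 19) = T19 at *
  generalize TT (t ^ 15) (-t ^ 11) = T11 at *
  generalize TT (t ^ 15) (-t ^ 13) = T13 at *
  generalize TT (t ^ 15) (-t ^ 7) = T7 at *
  generalize TT (t ^ 15) (-t ^ 5) = T5 at *
  generalize TT (t ^ 15) (-t) = T1 at *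
  linear_combination hB + T5 * r25 - t ^ 2 * T11 * s37 + t ^ 2 * T7 * r19 + t ^ 10 * T17 * s49
    - t ^ 8 * T19 * r17

/-! ### Fifth roots of unity -/

lemma norm_cert {ζ : ℂ} (h : 1 + ζ + ζ ^ 2 + ζ ^ 3 + ζ ^ 4 = 0) (a x y : ℂ) :
    (a - x + y) * (a - ζ * x + ζ ^ 2 * y) * (a - ζ ^ 2 * x + (ζ ^ 2) ^ 2 * y) *
      (a - ζ ^ 3 * x + (ζ ^ 3) ^ 2 * y) * (a - ζ ^ 4 * x + (ζ ^ 4) ^ 2 * y) =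
      a ^ 5 + y ^ 5 - x ^ 5 + 5 * a * x ^ 3 * y - 5 * a ^ 2 * x * y ^ 2 := by
  linear_combination (- 1*a^4*x^1 + 1*a^4*y^1*ζ^4 - 1*a^4*y^1*ζ^3 + 1*a^4*y^1*ζ^2 - 1*a^4*y^1*ζ^1 + 1*a^4*y^1 + 1*a^3*x^2*ζ^3 + 1*a^3*x^2*ζ^1 - 1*a^3*x^1*y^1*ζ^7 - 1*a^3*x^1*y^1*ζ^6 + 1*a^3*x^1*y^1*ζ^5 - 2*a^3*x^1*y^1*ζ^4 + 1*a^3*x^1*y^1*ζ^3 - 1*a^3*x^1*y^1*ζ^2 - 1*a^3*x^1*y^1*ζ^1 + 1*a^3*y^2*ζ^10 - 1*a^3*y^2*ζ^9 + 1*a^3*y^2*ζ^8 - 1*a^3*y^2*ζ^7 + 2*a^3*y^2*ζ^6 - 1*a^3*y^2*ζ^5 + 1*a^3*y^2*ζ^4 - 1*a^3*y^2*ζ^3 + 1*a^3*y^2*ζ^2 - 1*a^2*x^3*ζ^5 - 1*a^2*x^3*ζ^3 + 1*a^2*x^2*y^1*ζ^9 + 1*a^2*x^2*y^1*ζ^8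 + 2*a^2*x^2*y^1*ζ^7 - 2*a^2*x^2*y^1*ζ^6 + 2*a^2*x^2*y^1*ζ^5 + 1*a^2*x^2*y^1*ζ^4 + 1*a^2*x^2*y^1*ζ^3 - 1*a^2*x^1*y^2*ζ^12 - 1*a^2*x^1*y^2*ζ^11 - 1*a^2*x^1*y^2*ζ^8 - 5*a^2*x^1*y^2*ζ^6 + 4*a^2*x^1*y^2*ζ^5 - 1*a^2*x^1*y^2*ζ^4 - 5*a^2*x^1*y^2*ζ^1 + 5*a^2*x^1*y^2 + 1*a^2*y^3*ζ^14 - 1*a^2*y^3*ζ^13 + 1*a^2*y^3*ζ^12 - 1*a^2*y^3*ζ^11 + 2*a^2*y^3*ζ^10 - 1*a^2*y^3*ζ^9 + 1*a^2*y^3*ζ^8 - 1*a^2*y^3*ζ^7 + 1*a^2*y^3*ζ^6 + 1*a^1*x^4*ζ^6 - 1*a^1*x^3*y^1*ζ^10 - 1*a^1*x^3*y^1*ζ^9 - 1*a^1*x^3*y^1*ζ^8 - 1*a^1*x^3*y^1*ζ^7 + 4*a^1*x^3*y^1*ζ^6 - 5*a^1*x^3*y^1*ζ^5 + 5*a^1*x^3*y^1*ζ^1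 - 5*a^1*x^3*y^1 + 1*a^1*x^2*y^2*ζ^13 + 1*a^1*x^2*y^2*ζ^12 + 2*a^1*x^2*y^2*ζ^11 - 2*a^1*x^2*y^2*ζ^10 + 2*a^1*x^2*y^2*ζ^9 + 1*a^1*x^2*y^2*ζ^8 + 1*a^1*x^2*y^2*ζ^7 - 1*a^1*x^1*y^3*ζ^15 - 1*a^1*x^1*y^3*ζ^14 + 1*a^1*x^1*y^3*ζ^13 - 2*a^1*x^1*y^3*ζ^12 + 1*a^1*x^1*y^3*ζ^11 - 1*a^1*x^1*y^3*ζ^10 - 1*a^1*x^1*y^3*ζ^9 + 1*a^1*y^4*ζ^16 - 1*a^1*y^4*ζ^15 + 1*a^1*y^4*ζ^14 - 1*a^1*y^4*ζ^13 + 1*a^1*y^4*ζ^12 - 1*x^5*ζ^6 + 1*x^5*ζ^5 - 1*x^5*ζ^1 + 1*x^5 + 1*x^4*y^1*ζ^10 - 1*x^3*y^2*ζ^13 - 1*x^3*y^2*ζ^11 + 1*x^2*y^3*ζ^15 + 1*x^2*y^3*ζ^13 - 1*x^1*y^4*ζ^16 + 1*y^5*ζ^16 - 1*y^5*ζ^15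 + 1*y^5*ζ^11 - 1*y^5*ζ^10 + 1*y^5*ζ^6 - 1*y^5*ζ^5 + 1*y^5*ζ^1 - 1*y^5) * h

lemma dis_zeta {q : ℂ} (hq0 : q ≠ 0) (hq : ‖q‖ < 1) :
    ∃ a y : ℂ, a * y = -(q * EE (q ^ 25)) ^ 2 ∧
      ∀ η : ℂ, η ^ 5 = 1 → EE (η * q) = a - η * (q * EE (q ^ 25)) + η ^ 2 * y := by
  obtain ⟨s, hs⟩ : ∃ s : ℂ, s ^ 2 = q := IsAlgClosed.exists_pow_nat_eq q (by norm_num)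
  have hs0 : s ≠ 0 := by rintro rfl; apply hq0; rw [← hs]; norm_num
  have hs1 : ‖s‖ < 1 := by
    rw [← hs, norm_pow] at hq
    exact (pow_lt_one_iff_of_nonneg (norm_nonneg _) (by norm_num)).1 hq
  refine ⟨av (s ^ 5), q ^ 2 * cv (s ^ 5), ?_, ?_⟩
  · have := av_cv (pow_ne_zero 5 hs0) (norm_pow_lt hs1 (n := 5) (by norm_num))
    rw [show (s ^ 5) ^ 10 = q ^ 25 by rw [← hs]; ring] at this
    linear_combination q ^ 2 * this
  · intro η hη
    have hη0 : η ≠ 0 := by rintro rfl; norm_num at hη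
    have hηn : ‖η‖ = 1 := by
      have : ‖η‖ ^ 5 = 1 := by rw [← norm_pow, hη, norm_one]
      exact (pow_eq_one_iff_of_nonneg (norm_nonneg _) (by norm_num)).1 this
    have h1 := pent_dis (s := η ^ 3 * s) (mul_ne_zero (pow_ne_zero _ hη0) hs0)
      (by rw [norm_mul, norm_pow, hηn]; simpa using hs1)
    have e2 : (η ^ 3 * s) ^ 2 = η * q := by
      rw [← hs]; linear_combination (η * s ^ 2) * hη
    have e5 : (η ^ 3 * s) ^ 5 = s ^ 5 := by
      linear_combination (s ^ 5 * (η ^ 10 + η ^ 5 + 1)) * hη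
    have e50 : (η ^ 3 * s) ^ 50 = q ^ 25 := by
      rw [show (η ^ 3 * s) ^ 50 = ((η ^ 3 * s) ^ 5) ^ 10 by ring, e5, ← hs]; ring
    have e4 : (η ^ 3 * s) ^ 4 = η ^ 2 * q ^ 2 := by
      rw [show (η ^ 3 * s) ^ 4 = ((η ^ 3 * s) ^ 2) ^ 2 by ring, e2]; ring
    rw [e50, e5, e4, e2] at h1
    rw [h1]; ring

noncomputable def Gf (q : ℂ) : ℂ := Df q - 5 * q * Cf q

lemma Gf_sum {ζ : ℂ} (h : 1 + ζ + ζ ^ 2 + ζ ^ 3 + ζ ^ 4 = 0) {q : ℂ} (hq0 : q ≠ 0) (hq : ‖q‖ < 1) :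
    ∑ j ∈ Finset.range 5, ζ ^ (2 * j) * Gf (ζ ^ j * q) = 0 := by
  have h5 := zeta5 h
  obtain ⟨a, y, hay, hE⟩ := dis_zeta hq0 hq
  have hF := EE_five h hq
  have n25 : ‖q ^ 25‖ < 1 := norm_pow_lt hq (by norm_num)
  have n5 : ‖q ^ 5‖ < 1 := norm_pow_lt hq (by norm_num)
  have e25 := EE_ne n25
  have e5 := EE_ne n5
  have hz : ∀ j : ℕ, (ζ ^ j) ^ 5 = 1 := fun j => by rw [← pow_mul, mul_comm, pow_mul, h5, one_pow]
  obtain ⟨x, hx⟩ : ∃ x, x = q * EE (q ^ 25) := ⟨_, rfl⟩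
  rw [← hx] at hay hE
  have hN : (a ^ 5 + y ^ 5 - x ^ 5 + 5 * a * x ^ 3 * y - 5 * a ^ 2 * x * y ^ 2) * EE (q ^ 25) =
      EE (q ^ 5) ^ 6 := by
    rw [← hF, ← norm_cert h, hE ζ h5, hE _ (hz 2), hE _ (hz 3), hE _ (hz 4)]
    have := hE 1 (by norm_num)
    rw [one_mul] at this
    rw [this]
    ring
  have hk : ∀ η : ℂ, η ^ 5 = 1 → Gf (η * q) =
      ((a ^ 5 - 35 * a ^ 2 * x * y ^ 2 - 5 * a * x ^ 3 * y - 6 * x ^ 5 + y ^ 5)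
      + η * (-10 * a ^ 4 * x + 10 * a ^ 2 * y ^ 3 + 40 * a * x ^ 2 * y ^ 2)
      + η ^ 2 * (5 * a ^ 4 * y + 5 * a ^ 3 * x ^ 2 - 15 * a * x * y ^ 3 - 15 * x ^ 3 * y ^ 2)
      + η ^ 4 * (10 * a ^ 3 * y ^ 2 + 40 * a ^ 2 * x ^ 2 * y - 10 * x * y ^ 4)) / EE (q ^ 5) := by
    intro η hη
    have hηn : ‖η‖ = 1 := by
      have : ‖η‖ ^ 5 = 1 := by rw [← norm_pow, hη, norm_one]
      exact (pow_eq_one_iff_of_nonneg (norm_nonneg _) (by norm_num)).1 this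
    have hne : EE (η * q) ≠ 0 := EE_ne (by rw [norm_mul, hηn]; simpa using hq)
    unfold Gf Df Cf
    rw [show (η * q) ^ 5 = q ^ 5 by rw [mul_pow, hη, one_mul]]
    have he := hE η hη
    generalize EE (η * q) = e at *
    obtain ⟨X, hX⟩ : ∃ X, X = η * x := ⟨_, rfl⟩
    obtain ⟨Y, hY⟩ : ∃ Y, Y = η ^ 2 * y := ⟨_, rfl⟩
    obtain ⟨N, hNN⟩ : ∃ N, N = a^4 + a^3*X - a^3*Y + a^2*X^2 - 2*a^2*X*Y + a^2*Y^2 + a*X^3 - 3*a*X^2*Y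
      - 2*a*X*Y^2 - a*Y^3 + X^4 + X^3*Y + X^2*Y^2 + X*Y^3 + Y^4 := ⟨_, rfl⟩
    have hNe : N * e = a ^ 5 + y ^ 5 - x ^ 5 + 5 * a * x ^ 3 * y - 5 * a ^ 2 * x * y ^ 2 := by
      rw [hNN, he, hX, hY]
      linear_combination (-5*a^2*x*y^2 + 5*a*x^3*y - x^5 + y^5*η^5 + y^5) * hη
    have hC : 5 * (η * q) * (EE (q ^ 5) ^ 5 / e) = 5 * X * N / EE (q ^ 5) := by
      rw [mul_div_assoc', div_eq_div_iff hne e5, hX, hx]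
      linear_combination (-5 * η * q) * hN + (-5 * η * q * EE (q ^ 25)) * hNe
    rw [hC, ← sub_div]
    congr 1
    rw [hNN, he, hX, hY]
    linear_combination (-35*a^2*x*y^2 + 10*a^2*y^3*η - 5*a*x^3*y + 40*a*x^2*y^2*η - 15*a*x*y^3*η^2
      + 5*a*y^4*η^3 - 6*x^5 - 15*x^3*y^2*η^2 + 5*x^2*y^3*η^3 - 10*x*y^4*η^4 + y^5*η^5 + y^5) * hη
      + η ^ 3 * (-15 * a ^ 2 * x + 5 * y ^ 3) * hay
  have s0 : 1 + ζ ^ 2 + ζ ^ 4 + ζ ^ 6 + ζ ^ 8 = 0 := by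
    linear_combination h + (ζ + ζ ^ 3) * h5
  have s1 : 1 + ζ ^ 3 + ζ ^ 6 + ζ ^ 9 + ζ ^ 12 = 0 := by
    linear_combination h + (ζ + ζ ^ 4 + ζ ^ 2 * (ζ ^ 5 + 1)) * h5
  have s2 : 1 + ζ ^ 4 + ζ ^ 8 + ζ ^ 12 + ζ ^ 16 = 0 := by
    linear_combination h + (ζ ^ 3 + ζ ^ 2 * (ζ ^ 5 + 1) + ζ * (ζ ^ 10 + ζ ^ 5 + 1)) * h5
  have s4 : 1 + ζ ^ 6 + ζ ^ 12 + ζ ^ 18 + ζ ^ 24 = 0 := by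
    linear_combination h + (ζ + ζ ^ 2 * (ζ ^ 5 + 1) + ζ ^ 3 * (ζ ^ 10 + ζ ^ 5 + 1)
      + ζ ^ 4 * (ζ ^ 15 + ζ ^ 10 + ζ ^ 5 + 1)) * h5
  simp only [Finset.sum_range_succ, Finset.sum_range_zero]
  rw [hk _ (hz 0), hk _ (hz 1), hk _ (hz 2), hk _ (hz 3), hk _ (hz 4)]
  generalize (a ^ 5 - 35 * a ^ 2 * x * y ^ 2 - 5 * a * x ^ 3 * y - 6 * x ^ 5 + y ^ 5) = k0
  generalize (-10 * a ^ 4 * x + 10 * a ^ 2 * y ^ 3 + 40 * a * x ^ 2 * y ^ 2) = k1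
  generalize (5 * a ^ 4 * y + 5 * a ^ 3 * x ^ 2 - 15 * a * x * y ^ 3 - 15 * x ^ 3 * y ^ 2) = k2
  generalize (10 * a ^ 3 * y ^ 2 + 40 * a ^ 2 * x ^ 2 * y - 10 * x * y ^ 4) = k4
  linear_combination (k0 * s0 + k1 * s1 + k2 * s2 + k4 * s4) / EE (q ^ 5)

lemma main_identity {ζ : ℂ} (h : 1 + ζ + ζ ^ 2 + ζ ^ 3 + ζ ^ 4 = 0) {q : ℂ} (hq0 : q ≠ 0)
    (hq : ‖q‖ < 1) :
    2 * q ^ 2 * ∑ j ∈ Finset.range 5, (Bf (ζ ^ j * q) + Bf (-(ζ ^ j * q))) =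
      ∑ j ∈ Finset.range 5, ζ ^ (3 * j) * (Cf (ζ ^ j * q) + Cf (-(ζ ^ j * q))) := by
  have h5 := zeta5 h
  have hn := zeta_norm h
  have hζ0 : ζ ≠ 0 := by rintro rfl; norm_num at h5
  have g1 := Gf_sum h hq0 hq
  have g2 := Gf_sum h (neg_ne_zero.2 hq0) (q := -q) (by simpa using hq)
  have hterm : ∀ j ∈ Finset.range 5, 10 * q * (2 * q ^ 2 * (Bf (ζ ^ j * q) + Bf (-(ζ ^ j * q)))) =
      10 * q * (ζ ^ (3 * j) * (Cf (ζ ^ j * q) + Cf (-(ζ ^ j * q)))) +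
      ζ ^ (2 * j) * Gf (ζ ^ j * q) - ζ ^ (2 * j) * Gf (ζ ^ j * -q) := by
    intro j _
    have e := etaIV (q := ζ ^ j * q) (mul_ne_zero (pow_ne_zero _ hζ0) hq0)
      (by rw [norm_mul, norm_pow, hn]; simpa using hq)
    have hz : (ζ ^ j) ^ 5 = 1 := by rw [← pow_mul, mul_comm, pow_mul, h5, one_pow]
    rw [show ζ ^ j * -q = -(ζ ^ j * q) by ring, mul_comm 2 j, mul_comm 3 j, pow_mul, pow_mul]
    unfold Gf
    linear_combination (ζ ^ j) ^ 2 * e - 20 * q ^ 3 * (Bf (ζ ^ j * q) + Bf (-(ζ ^ j * q))) * hz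
  apply mul_left_cancel₀ (mul_ne_zero (by norm_num : (10 : ℂ) ≠ 0) hq0)
  rw [Finset.mul_sum, Finset.mul_sum, Finset.sum_congr rfl hterm, Finset.sum_sub_distrib,
    Finset.sum_add_distrib, g1, g2, Finset.mul_sum]
  ring

/-! ### Comparing coefficients -/

lemma psi_ne {q : ℂ} (hq : ‖q‖ < 1) : psiNeg q ≠ 0 := by
  have h1 := EE_ne hq
  have h2 := EE_ne (norm_pow_lt hq (n := 2) (by norm_num))
  have h4 := EE_ne (norm_pow_lt hq (n := 4) (by norm_num))
  exact div_ne_zero (mul_ne_zero h1 h4) h2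

lemma Bf_ne {q : ℂ} (hq : ‖q‖ < 1) : Bf q ≠ 0 :=
  div_ne_zero (pow_ne_zero _ (psi_ne (norm_pow_lt hq (by norm_num)))) (psi_ne hq)

lemma Cf_ne {q : ℂ} (hq : ‖q‖ < 1) : Cf q ≠ 0 :=
  div_ne_zero (pow_ne_zero _ (EE_ne (norm_pow_lt hq (by norm_num)))) (EE_ne hq)

lemma hasSum_of_tsum {f : ℕ → ℂ} {v : ℂ} (h : ∑' n, f n = v) (hv : v ≠ 0) : HasSum f v := by
  have : Summable f := by
    by_contra hn
    rw [tsum_eq_zero_of_not_summable hn] at h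
    exact hv h.symm
  rw [← h]; exact this.hasSum

lemma coeffs_zero (e : ℕ → ℂ) (h : ∀ q : ℂ, ‖q‖ < 1 → HasSum (fun n => e n * q ^ n) 0) (n : ℕ) :
    e n = 0 := by
  have hp : HasFPowerSeriesAt (fun _ : ℂ => (0 : ℂ)) (FormalMultilinearSeries.ofScalars ℂ e) 0 := by
    rw [hasFPowerSeriesAt_iff]
    filter_upwards [Metric.ball_mem_nhds (0 : ℂ) one_pos] with z hz
    have := h z (by simpa using hz)
    simpa [FormalMultilinearSeries.coeff_ofScalars, mul_comm] using this
  have h0 := HasFPowerSeriesAt.eq_zero hp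
  have h1 : (FormalMultilinearSeries.ofScalars ℂ e).coeff n = 0 := by
    rw [h0]; rfl
  simpa [FormalMultilinearSeries.coeff_ofScalars] using h1

lemma char_sum {ζ : ℂ} (hζ : IsPrimitiveRoot ζ 5) (N : ℕ) :
    ∑ j ∈ Finset.range 5, (ζ ^ j) ^ N * (1 + (-1) ^ N) = if 10 ∣ N then 10 else 0 := by
  rcases Nat.even_or_odd N with hN | hN
  · rw [hN.neg_one_pow]
    have e : ∀ j ∈ Finset.range 5, (ζ ^ j) ^ N * (1 + (1 : ℂ)) = 2 * (ζ ^ N) ^ j := by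
      intro j _
      rw [← pow_mul, ← pow_mul, mul_comm j]; ring
    rw [Finset.sum_congr rfl e, ← Finset.mul_sum]
    by_cases h5 : 5 ∣ N
    · have h10 : 10 ∣ N := by have := hN.two_dvd; omega
      rw [if_pos h10, (hζ.pow_eq_one_iff_dvd N).2 h5]
      norm_num
    · have h10 : ¬ 10 ∣ N := by omega
      rw [if_neg h10]
      have hc : N.Coprime 5 := by
        rw [Nat.coprime_comm]
        exact (Nat.Prime.coprime_iff_not_dvd (by norm_num)).2 h5
      rw [(hζ.pow_of_coprime N hc).geom_sum_eq_zero (by norm_num), mul_zero]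
  · rw [hN.neg_one_pow]
    have h10 : ¬ 10 ∣ N := by
      have := Nat.odd_iff.1 hN
      omega
    simp [h10]

lemma avg_hasSum {ζ : ℂ} (hζ : ‖ζ‖ = 1) (b : ℕ → ℤ) (F : ℂ → ℂ) (m : ℕ)
    (hF : ∀ q : ℂ, ‖q‖ < 1 → HasSum (fun n => (b n : ℂ) * q ^ n) (F q)) {q : ℂ} (hq : ‖q‖ < 1) :
    HasSum (fun n => (b n : ℂ) * q ^ n * ∑ j ∈ Finset.range 5, ζ ^ (m * j) * ((ζ ^ j) ^ n * (1 + (-1) ^ n)))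
      (∑ j ∈ Finset.range 5, ζ ^ (m * j) * (F (ζ ^ j * q) + F (-(ζ ^ j * q)))) := by
  have h : ∀ j ∈ Finset.range 5, HasSum (fun n => ζ ^ (m * j) * ((b n : ℂ) * (ζ ^ j * q) ^ n +
      (b n : ℂ) * (-(ζ ^ j * q)) ^ n)) (ζ ^ (m * j) * (F (ζ ^ j * q) + F (-(ζ ^ j * q)))) := by
    intro j _
    have hn : ‖ζ ^ j * q‖ < 1 := by rw [norm_mul, norm_pow, hζ]; simpa using hq
    exact ((hF _ hn).add (hF _ (by rwa [norm_neg]))).mul_left _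
  convert hasSum_sum h using 1
  funext n
  rw [Finset.mul_sum]
  refine Finset.sum_congr rfl fun j _ => ?_
  rw [neg_pow, mul_pow]
  ring

theorem stmt_13 (c b : ℕ → ℤ)
    (hc : ∀ q : ℂ, ‖q‖ < 1 →
      ∑' n : ℕ, (c n : ℂ) * q ^ n = qpoch (q ^ 5) (q ^ 5) ^ 5 / qpoch q q)
    (hb : ∀ q : ℂ, ‖q‖ < 1 →
      ∑' n : ℕ, (b n : ℂ) * q ^ n = psiNeg (q ^ 5) ^ 5 / psiNeg q) :
    ∀ n : ℕ, 2 * b (10 * n) = c (10 * n + 2) := by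
  have hC : ∀ q : ℂ, ‖q‖ < 1 → HasSum (fun n => (c n : ℂ) * q ^ n) (Cf q) :=
    fun q hq => hasSum_of_tsum (hc q hq) (Cf_ne hq)
  have hB : ∀ q : ℂ, ‖q‖ < 1 → HasSum (fun n => (b n : ℂ) * q ^ n) (Bf q) :=
    fun q hq => hasSum_of_tsum (hb q hq) (Bf_ne hq)
  obtain ⟨ζ, hζ⟩ : ∃ ζ : ℂ, IsPrimitiveRoot ζ 5 :=
    ⟨_, Complex.isPrimitiveRoot_exp 5 (by norm_num)⟩
  have h : 1 + ζ + ζ ^ 2 + ζ ^ 3 + ζ ^ 4 = 0 := by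
    have := hζ.geom_sum_eq_zero (by norm_num)
    simp only [Finset.sum_range_succ, Finset.sum_range_zero] at this
    linear_combination this
  have hn := zeta_norm h
  have h5 := zeta5 h
  set e : ℕ → ℂ := fun N => (if 10 ∣ N + 8 then 10 else 0) *
    ((c N : ℂ) - if N < 2 then 0 else 2 * (b (N - 2) : ℂ)) with he
  have e0 : e 0 = 0 := by simp [he]
  have e1 : e 1 = 0 := by simp [he]
  have main : ∀ q : ℂ, ‖q‖ < 1 → HasSum (fun n => e n * q ^ n) 0 := by
    intro q hq
    by_cases hq0 : q = 0
    · subst hq0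
      convert (hasSum_zero : HasSum (fun _ : ℕ => (0 : ℂ)) 0) using 1
      funext n
      rcases n with _ | n
      · simp [e0]
      · simp
    have m := main_identity h hq0 hq
    have sC := avg_hasSum hn c Cf 3 hC hq
    have sB := (avg_hasSum hn b Bf 0 hB hq).mul_left (2 * q ^ 2)
    simp only [zero_mul, pow_zero, one_mul] at sB
    rw [m] at sB
    have tC : ∀ n : ℕ, ∑ j ∈ Finset.range 5, ζ ^ (3 * j) * ((ζ ^ j) ^ n * (1 + (-1) ^ n)) =
        if 10 ∣ n + 8 then (10 : ℂ) else 0 := by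
      intro n
      rw [← char_sum hζ (n + 8)]
      refine Finset.sum_congr rfl fun j _ => ?_
      have hz : (ζ ^ j) ^ 5 = 1 := by rw [← pow_mul, mul_comm, pow_mul, h5, one_pow]
      rw [mul_comm 3 j, pow_mul, pow_add, pow_add (-1 : ℂ)]
      linear_combination (-(ζ ^ j) ^ 3 * (ζ ^ j) ^ n * (1 + (-1) ^ n)) * hz
    simp only [tC] at sC
    simp only [char_sum hζ] at sB
    generalize ∑ j ∈ Finset.range 5, ζ ^ (3 * j) * (Cf (ζ ^ j * q) + Cf (-(ζ ^ j * q))) = V at *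
    rw [← hasSum_nat_add_iff' 2] at sC ⊢
    simp only [Finset.sum_range_succ, Finset.sum_range_zero, e0, e1] at sC ⊢
    norm_num at sC ⊢
    have := sC.sub sB
    rw [sub_self] at this
    convert this using 1
    funext n
    have hd : (10 ∣ n + 2 + 8) ↔ 10 ∣ n := by omega
    simp only [he, hd]
    split_ifs <;> first | omega | (simp only [Nat.add_sub_cancel]; ring)
  intro n
  have := coeffs_zero e main (10 * n + 2)
  have hd : 10 ∣ 10 * n + 2 + 8 := by omega
  have hl : ¬ (10 * n + 2 < 2) := by omega
  simp only [he, if_pos hd, if_neg hl, Nat.add_sub_cancel] at this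
  have h2 : (2 * (b (10 * n) : ℂ)) = c (10 * n + 2) := by linear_combination (-1 / 10) * this
  exact_mod_cast h2
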